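/- arXiv:1210.1635 — 2 statements merged into one kernel-verified Lean document; each statement's English description precedes it below -/
import Mathlib

section
/- Let (W,S) be an infinite, irreducible, non-affine right-angled Coxeter system with S finite, and let T be a proper normal subgroup of W of finite index n = [W:T] ≥ 2. Let w be a reduced word over S representing an element of T in which the generator s ∈ S does not occur, and let s′, s″ ∈ S satisfy ss′ ≠ s′s and s′s″ ≠ s″s′. Then the element of W represented by (s′s″ss′s″)ⁿw lies in T, and every reduced word r′ over S representing this element is s-good and s″-good; moreover, for every t ∈ S ∖ {s, s′, s″}, if w is t-good then r′ is t-good. -/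
/-- A Coxeter matrix is right-angled if all off-diagonal entries are `2` or `∞`
(`0` encodes `∞` in Mathlib's convention, i.e. the order of `st` is `2` or `∞`). -/
def CoxeterMatrix.IsRightAngled {B : Type*} (M : CoxeterMatrix B) : Prop :=
  ∀ i j : B, i ≠ j → M i j = 2 ∨ M i j = 0

namespace CoxeterSystem

variable {B : Type*} {W : Type*} [Group W] {M : CoxeterMatrix B} (cs : CoxeterSystem M W)

/-- The Coxeter system is irreducible: the generating set cannot be partitioned into two
nonempty subsets such that every generator in one commutes with every generator in the
other. -/
def IsIrreducible : Prop :=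
  ¬ ∃ A : Set B, A.Nonempty ∧ Aᶜ.Nonempty ∧
      ∀ i ∈ A, ∀ j ∈ Aᶜ, Commute (cs.simple i) (cs.simple j)

/-- A word over `S` is reduced if no shorter word represents the same element of `W`. -/
def ReducedWord (l : List B) : Prop :=
  ∀ l' : List B, cs.wordProd l' = cs.wordProd l → l.length ≤ l'.length

/-- An element `w ∈ W` is essential if the only parabolic subgroup containing it is `W`
itself: whenever `w ∈ u W_J u⁻¹` (equivalently `u⁻¹ w u ∈ W_J`), one has `J = S`. -/
def IsEssential (w : W) : Prop :=
  ∀ (u : W) (J : Set B),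
    u⁻¹ * w * u ∈ Subgroup.closure (cs.simple '' J) → J = Set.univ

/-- `t` is an `s`-blocker if the generators `s` and `t` do not commute. -/
def IsBlocker (s t : B) : Prop := ¬ Commute (cs.simple s) (cs.simple t)

/-- A word is `s`-minimal if between any two consecutive occurrences of `s`
there is an `s`-blocker (vacuously so if `s` occurs at most once). -/
def SMinimal (l : List B) (s : B) : Prop :=
  ∀ l₁ l₂ l₃ : List B, l = l₁ ++ s :: l₂ ++ s :: l₃ → s ∉ l₂ →
    ∃ t ∈ l₂, cs.IsBlocker s t

/-- A word `l` is `s`-good if it is `s`-minimal and, whenever `s` occurs at least twice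
(with `l₁` the prefix before the first occurrence of `s` and `l₃` the suffix after the
last occurrence), the word `l₃ ++ l₁` contains an `s`-blocker. -/
def SGood (l : List B) (s : B) : Prop :=
  cs.SMinimal l s ∧
    ∀ l₁ l₂ l₃ : List B, l = l₁ ++ s :: l₂ ++ s :: l₃ → s ∉ l₁ → s ∉ l₃ →
      ∃ t ∈ l₃ ++ l₁, cs.IsBlocker s t

/-- `B(w)`: the set of "bad" generators of a word, i.e. those for which the word is
not good. -/
def badSet (l : List B) : Set B := {s : B | ¬ cs.SGood l s}

end CoxeterSystem

/-- A group is affine (in the sense relevant here) if it contains a free abelian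
subgroup of finite index. -/
def IsVirtuallyFreeAbelian (W : Type*) [Group W] : Prop :=
  ∃ H : Subgroup W, H.FiniteIndex ∧ ∃ ι : Type, Nonempty (H ≃* Multiplicative (ι →₀ ℤ))

namespace CoxeterSystem

variable {B : Type*} {W : Type*} [Group W] {M : CoxeterMatrix B} (cs : CoxeterSystem M W)

theorem reducedWord_iff_isReduced (r : List B) : cs.ReducedWord r ↔ cs.IsReduced r := by
  constructor
  · intro h
    obtain ⟨r', hr', e⟩ := cs.exists_isReduced (cs.wordProd r)
    have h1 := h r' e.symm
    have h2 := cs.length_wordProd_le r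
    have h3 := hr'.eq
    rw [← e] at h3
    exact le_antisymm h2 (h3 ▸ h1)
  · intro h l' e
    rw [← h.eq, ← e]
    exact cs.length_wordProd_le l'

theorem commute_simple_of_eq_two {i j : B} (h : M i j = 2) :
    Commute (cs.simple i) (cs.simple j) := by
  have h1 := cs.simple_mul_simple_pow i j
  rw [h, pow_two] at h1
  have h2 := eq_inv_of_mul_eq_one_left h1
  rw [mul_inv_rev, cs.inv_simple, cs.inv_simple] at h2
  exact h2

/-- In a right-angled Coxeter group, a map on generators extends to the group as soon as it
sends generators to involutions and preserves the commutation relations. -/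
theorem isLiftable_of_isRightAngled (hra : M.IsRightAngled) {G : Type*} [Monoid G] (f : B → G)
    (hsq : ∀ i, f i * f i = 1)
    (hcomm : ∀ i j, i ≠ j → M i j = 2 → Commute (f i) (f j)) : M.IsLiftable f := by
  intro i j
  by_cases hij : i = j
  · subst hij
    simp [hsq]
  · rcases hra i j hij with h | h
    · rw [h, (hcomm i j hij h).mul_pow, pow_two, pow_two, hsq, hsq, one_mul]
    · rw [h, pow_zero]

open Classical in
/-- The action of a simple reflection on `W × ZMod 2`: conjugate the first coordinate, and flip
the second one if the first coordinate is that reflection. -/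
noncomputable def signedConj (i : B) (p : W × ZMod 2) : W × ZMod 2 :=
  (cs.simple i * p.1 * cs.simple i, p.2 + if p.1 = cs.simple i then 1 else 0)

open Classical in
theorem signedConj_mk (i : B) (x : W) (e : ZMod 2) :
    cs.signedConj i (x, e) =
      (cs.simple i * x * cs.simple i, e + if x = cs.simple i then 1 else 0) := rfl

theorem simple_conj_eq_simple_iff {i j : B} (hij : Commute (cs.simple i) (cs.simple j)) (x : W) :
    cs.simple j * x * cs.simple j = cs.simple i ↔ x = cs.simple i := by
  constructor
  · intro h
    have := congrArg (fun y ↦ cs.simple j * y * cs.simple j) h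
    rw [← hij.eq] at this
    simpa [mul_assoc] using this
  · rintro rfl
    rw [← hij.eq]
    simp

theorem signedConj_signedConj (i : B) (p : W × ZMod 2) :
    cs.signedConj i (cs.signedConj i p) = p := by
  obtain ⟨x, e⟩ := p
  classical
  rw [cs.signedConj_mk i x e, signedConj_mk,
    if_congr (cs.simple_conj_eq_simple_iff (Commute.refl (cs.simple i)) x) rfl rfl]
  have h : (1 + 1 : ZMod 2) = 0 := rfl
  ext
  · simp [mul_assoc]
  · split_ifs <;> simp [add_assoc, h]

theorem signedConj_comm {i j : B} (hij : Commute (cs.simple i) (cs.simple j)) (p : W × ZMod 2) :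
    cs.signedConj i (cs.signedConj j p) = cs.signedConj j (cs.signedConj i p) := by
  obtain ⟨x, e⟩ := p
  classical
  simp only [signedConj_mk]
  rw [if_congr (cs.simple_conj_eq_simple_iff hij x) rfl rfl,
    if_congr (cs.simple_conj_eq_simple_iff hij.symm x) rfl rfl]
  ext
  · calc cs.simple i * (cs.simple j * x * cs.simple j) * cs.simple i
        = (cs.simple i * cs.simple j) * x * (cs.simple j * cs.simple i) := by
          simp only [mul_assoc]
      _ = (cs.simple j * cs.simple i) * x * (cs.simple i * cs.simple j) := by rw [hij.eq]
      _ = _ := by simp only [mul_assoc]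
  · exact add_right_comm _ _ _

theorem exists_signedConj_hom (hra : M.IsRightAngled) :
    ∃ φ : W →* Function.End (W × ZMod 2), ∀ i, φ (cs.simple i) = cs.signedConj i := by
  have hl : M.IsLiftable (G := Function.End (W × ZMod 2)) cs.signedConj :=
    isLiftable_of_isRightAngled hra _ (fun i ↦ funext (cs.signedConj_signedConj i))
      (fun i j _ h ↦ funext (cs.signedConj_comm (cs.commute_simple_of_eq_two h)))
  exact ⟨cs.lift ⟨_, hl⟩, fun i ↦ cs.lift_apply_simple hl i⟩

open Classical in
theorem signedConj_hom_wordProd {φ : W →* Function.End (W × ZMod 2)}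
    (hφ : ∀ i, φ (cs.simple i) = cs.signedConj i) (r : List B) (p : W × ZMod 2) :
    φ (cs.wordProd r) p = (cs.wordProd r * p.1 * (cs.wordProd r)⁻¹,
      p.2 + ((cs.rightInvSeq r).count p.1 : ℕ)) := by
  induction r with
  | nil =>
    rw [cs.wordProd_nil, map_one]
    simp [Function.End.one_def]
  | cons i r ih =>
    rw [cs.wordProd_cons, map_mul]
    change φ (cs.simple i) (φ (cs.wordProd r) p) = _
    have h : cs.wordProd r * p.1 * (cs.wordProd r)⁻¹ = cs.simple i ↔
        (cs.wordProd r)⁻¹ * cs.simple i * cs.wordProd r = p.1 := by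
      constructor
      · intro h
        rw [← h]
        group
      · intro h
        rw [← h]
        group
    rw [ih, hφ]
    rw [signedConj_mk, if_congr h rfl rfl]
    simp only [rightInvSeq, List.count_cons, beq_iff_eq]
    ext
    · simp [mul_assoc]
    · simp [add_assoc]

theorem mem_rightInvSeq_of_isRightDescent (hra : M.IsRightAngled) {r : List B} {t : B}
    (h : cs.IsRightDescent (cs.wordProd r) t) : cs.simple t ∈ cs.rightInvSeq r := by
  classical
  obtain ⟨φ, hφ⟩ := cs.exists_signedConj_hom hra
  obtain ⟨r₀, hr₀, e⟩ := cs.exists_isReduced (cs.wordProd r * cs.simple t)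
  have e' : cs.wordProd (r₀.concat t) = cs.wordProd r := by
    rw [cs.wordProd_concat, ← e]
    simp
  have hred : cs.IsReduced (r₀.concat t) := by
    have h1 := cs.isRightDescent_iff.mp h
    rw [e, hr₀.eq] at h1
    rw [IsReduced, e', ← h1]
    simp
  have hcount : (cs.rightInvSeq (r₀.concat t)).count (cs.simple t) = 1 := by
    apply List.count_eq_one_of_mem hred.nodup_rightInvSeq
    rw [rightInvSeq_concat]
    simp
  have h1 := cs.signedConj_hom_wordProd hφ r (cs.simple t, 0)
  have h2 := cs.signedConj_hom_wordProd hφ (r₀.concat t) (cs.simple t, 0)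
  rw [e', h1, hcount] at h2
  have h3 := congrArg Prod.snd h2
  by_contra hn
  rw [List.count_eq_zero_of_not_mem hn] at h3
  simp at h3

theorem eq_of_conj_simple (hra : M.IsRightAngled) {i j : B} {x : W}
    (h : x * cs.simple i * x⁻¹ = cs.simple j) : i = j := by
  classical
  have hl : M.IsLiftable (fun k ↦ Multiplicative.ofAdd (if k = i then (1 : ZMod 2) else 0)) :=
    isLiftable_of_isRightAngled hra _
      (fun k ↦ by
        rw [← ofAdd_add, ← ofAdd_zero]
        congr 1
        split_ifs <;> rfl)
      (fun _ _ _ _ ↦ Commute.all _ _)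
  have h1 := congrArg (cs.lift ⟨_, hl⟩) h
  rw [map_mul, map_mul, map_inv, mul_inv_cancel_comm, cs.lift_apply_simple,
    cs.lift_apply_simple] at h1
  by_contra hij
  simp [Ne.symm hij] at h1

/-- The exchange condition, with the extra information available in the right-angled case. -/
theorem exchange (hra : M.IsRightAngled) {r : List B} {t : B}
    (h : cs.IsLeftDescent (cs.wordProd r) t) :
    ∃ a b, r = a ++ t :: b ∧ Commute (cs.simple t) (cs.wordProd a) := by
  have h1 : cs.IsRightDescent (cs.wordProd r.reverse) t := by
    rwa [wordProd_reverse, isRightDescent_inv_iff]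
  have h2 := cs.mem_rightInvSeq_of_isRightDescent hra h1
  rw [rightInvSeq_reverse, List.mem_reverse, List.mem_iff_getElem] at h2
  obtain ⟨j, hj, h2⟩ := h2
  have hj' : j < r.length := by simpa using hj
  rw [getElem_leftInvSeq _ _ _ hj'] at h2
  have h3 := cs.eq_of_conj_simple hra h2
  refine ⟨r.take j, r.drop (j + 1), ?_, ?_⟩
  · rw [← h3]
    simp
  · rw [h3] at h2
    exact (eq_mul_inv_iff_mul_eq.mp h2.symm)

/-- The alternating word of length `k` in the letters `t`, `u`, starting with `t`. -/
def alternating {B : Type*} : ℕ → B → B → List B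
  | 0, _, _ => []
  | k + 1, t, u => t :: alternating k u t

@[simp] theorem length_alternating {B : Type*} (k : ℕ) (t u : B) :
    (alternating k t u).length = k := by
  induction k generalizing t u with
  | zero => rfl
  | succ k ih => simp [alternating, ih]

theorem take_alternating {B : Type*} {j k : ℕ} (h : j ≤ k) (t u : B) :
    (alternating k t u).take j = alternating j t u := by
  induction k generalizing t u j with
  | zero =>
    obtain rfl : j = 0 := by lia
    rfl
  | succ k ih =>
    cases j with
    | zero => rfl
    | succ j => simp [alternating, ih (Nat.le_of_succ_le_succ h)]

theorem exists_dihedral_hom (hra : M.IsRightAngled) {t u : B}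
    (htu : ¬ Commute (cs.simple t) (cs.simple u)) :
    ∃ f : W →* DihedralGroup 0,
      f (cs.simple t) = DihedralGroup.sr 0 ∧ f (cs.simple u) = DihedralGroup.sr 1 := by
  classical
  have hne : u ≠ t := by
    rintro rfl
    exact htu (Commute.refl _)
  let f : B → DihedralGroup 0 := fun k ↦
    if k = t then DihedralGroup.sr 0 else if k = u then DihedralGroup.sr 1 else 1
  have hl : M.IsLiftable f := by
    refine isLiftable_of_isRightAngled hra f (fun k ↦ ?_) (fun i j hij h ↦ ?_)
    · simp only [f]
      split_ifs <;> simp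
    · have hc := cs.commute_simple_of_eq_two h
      by_cases h1 : i = t
      · have h2 : j ≠ u := by
          rintro rfl
          exact htu (h1 ▸ hc)
        have h3 : j ≠ t := fun h3 ↦ hij (h1.trans h3.symm)
        simp [f, h2, h3]
      · by_cases h2 : i = u
        · have h3 : j ≠ t := by
            rintro rfl
            exact htu (h2 ▸ hc.symm)
          have h4 : j ≠ u := fun h4 ↦ hij (h2.trans h4.symm)
          simp [f, h3, h4]
        · simp [f, h1, h2]
  refine ⟨cs.lift ⟨f, hl⟩, ?_, ?_⟩
  · rw [cs.lift_apply_simple]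
    simp [f]
  · rw [cs.lift_apply_simple]
    simp [f, hne]

theorem eq_zero_of_commute_alternating (hra : M.IsRightAngled) {t u : B}
    (htu : ¬ Commute (cs.simple t) (cs.simple u)) {j : ℕ}
    (h : Commute (cs.simple t) (cs.wordProd (alternating j u t))) : j = 0 := by
  obtain ⟨f, ft, fu⟩ := cs.exists_dihedral_hom hra htu
  have key : ∀ m : ℕ,
      f (cs.wordProd (alternating (2 * m) u t)) = DihedralGroup.r (-(m : ZMod 0)) ∧
      f (cs.wordProd (alternating (2 * m + 1) u t)) = DihedralGroup.sr (1 + (m : ZMod 0)) := by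
    intro m
    induction m with
    | zero => simp [alternating, fu]
    | succ m ih =>
      have h2 : ∀ i : ℕ, f (cs.wordProd (alternating (i + 2) u t)) =
          DihedralGroup.r (0 - 1) * f (cs.wordProd (alternating i u t)) := by
        intro i
        simp only [alternating, wordProd_cons, map_mul, ft, fu]
        rw [← mul_assoc, DihedralGroup.sr_mul_sr]
      constructor
      · rw [show 2 * (m + 1) = 2 * m + 2 by ring, h2, ih.1, DihedralGroup.r_mul_r]
        congr 1
        push_cast
        ring
      · rw [show 2 * (m + 1) + 1 = 2 * m + 1 + 2 by ring, h2, ih.2, DihedralGroup.r_mul_sr]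
        congr 1
  have h1 := (h.map f).eq
  rw [ft] at h1
  rcases Nat.even_or_odd' j with ⟨m, rfl | rfl⟩
  · rw [(key m).1, DihedralGroup.sr_mul_r, DihedralGroup.r_mul_sr] at h1
    have h2 : (0 : ZMod 0) + -(m : ZMod 0) = 0 - -(m : ZMod 0) := by injection h1
    have h3 : ((2 * m : ℕ) : ZMod 0) = 0 := by
      push_cast
      linear_combination -h2
    simpa [ZMod.natCast_eq_zero_iff] using h3
  · rw [(key m).2, DihedralGroup.sr_mul_sr, DihedralGroup.sr_mul_sr] at h1
    have h2 : (1 + (m : ZMod 0)) - 0 = 0 - (1 + (m : ZMod 0)) := by injection h1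
    have h3 : ((2 * m + 2 : ℕ) : ZMod 0) = 0 := by
      push_cast
      linear_combination h2
    rw [ZMod.natCast_eq_zero_iff] at h3
    simp at h3

theorem IsReduced.of_wordProd_eq {cs : CoxeterSystem M W} {r r' : List B} (h : cs.IsReduced r)
    (e : cs.wordProd r' = cs.wordProd r) (hl : r'.length = r.length) : cs.IsReduced r' := by
  rw [IsReduced, e, h.eq, hl]

theorem wordProd_append_cons_of_commute {a b : List B} {t : B}
    (h : Commute (cs.simple t) (cs.wordProd a)) :
    cs.wordProd (a ++ t :: b) = cs.wordProd (t :: (a ++ b)) := by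
  simp only [wordProd_append, wordProd_cons, ← mul_assoc, h.eq]

theorem exists_alternating_succ (hra : M.IsRightAngled) {t u : B}
    (htu : ¬ Commute (cs.simple t) (cs.simple u)) {k : ℕ} {r : List B}
    (hr : cs.IsReduced (alternating k u t ++ r))
    (h : cs.IsLeftDescent (cs.wordProd (alternating k u t ++ r)) t) :
    ∃ r', cs.IsReduced (alternating (k + 1) t u ++ r') ∧
      cs.wordProd (alternating (k + 1) t u ++ r') = cs.wordProd (alternating k u t ++ r) := by
  obtain ⟨a, b, e, hc⟩ := cs.exchange hra h
  by_cases hk : k ≤ a.length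
  · obtain ⟨a', rfl⟩ : ∃ a', a = alternating k u t ++ a' := by
      refine ⟨a.drop k, ?_⟩
      have := congrArg (List.take k) e
      rw [List.take_append_of_le_length (by simp), List.take_append_of_le_length hk,
        List.take_of_length_le (by simp)] at this
      rw [this, List.take_append_drop]
    have e2 : cs.wordProd (alternating (k + 1) t u ++ (a' ++ b)) =
        cs.wordProd (alternating k u t ++ r) := by
      rw [e, cs.wordProd_append_cons_of_commute hc]
      simp [alternating]
    refine ⟨a' ++ b, hr.of_wordProd_eq e2 ?_, e2⟩
    rw [e]
    simp
    lia
  · exfalso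
    rw [not_le] at hk
    have ha : a = alternating a.length u t := by
      have := congrArg (List.take a.length) e
      rw [List.take_append_of_le_length (by simp; lia), take_alternating hk.le] at this
      simpa using this.symm
    rw [ha] at hc
    have h0 := cs.eq_zero_of_commute_alternating hra htu hc
    obtain ⟨k, rfl⟩ : ∃ k', k = k' + 1 := ⟨k - 1, by lia⟩
    rw [List.length_eq_zero_iff] at h0
    subst h0
    simp only [alternating, List.cons_append, List.nil_append, List.cons.injEq] at e
    exact htu (e.1 ▸ Commute.refl _)

theorem exists_alternating_of_isLeftDescent (hra : M.IsRightAngled) {t u : B} {g : W}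
    (htu : ¬ Commute (cs.simple t) (cs.simple u)) (ht : cs.IsLeftDescent g t)
    (hu : cs.IsLeftDescent g u) (k : ℕ) :
    (∃ r, cs.IsReduced (alternating k t u ++ r) ∧ cs.wordProd (alternating k t u ++ r) = g) ∧
    ∃ r, cs.IsReduced (alternating k u t ++ r) ∧ cs.wordProd (alternating k u t ++ r) = g := by
  induction k with
  | zero =>
    obtain ⟨r, hr, e⟩ := cs.exists_isReduced g
    exact ⟨⟨r, hr, e.symm⟩, ⟨r, hr, e.symm⟩⟩
  | succ k ih =>
    obtain ⟨⟨r, hr, rfl⟩, ⟨r', hr', e⟩⟩ := ih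
    constructor
    · rw [← e] at ht ⊢
      exact cs.exists_alternating_succ hra htu hr' ht
    · exact cs.exists_alternating_succ hra (fun h ↦ htu h.symm) hr hu

/-- Two left descents of an element of a right-angled Coxeter group commute. -/
theorem commute_of_isLeftDescent (hra : M.IsRightAngled) {t u : B} {g : W}
    (ht : cs.IsLeftDescent g t) (hu : cs.IsLeftDescent g u) :
    Commute (cs.simple t) (cs.simple u) := by
  by_contra htu
  obtain ⟨⟨r, hr, e⟩, -⟩ :=
    cs.exists_alternating_of_isLeftDescent hra htu ht hu (cs.length g + 1)
  have h := hr.eq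
  rw [e, List.length_append, length_alternating] at h
  lia

/-- The first occurrence of `t` in the word is preceded only by letters that commute with `t`. -/
def OccursFirst (r : List B) (t : B) : Prop :=
  ∃ a b, r = a ++ t :: b ∧ ∀ u ∈ a, u ≠ t ∧ Commute (cs.simple t) (cs.simple u)

theorem commute_wordProd {t : B} {a : List B}
    (h : ∀ u ∈ a, Commute (cs.simple t) (cs.simple u)) :
    Commute (cs.simple t) (cs.wordProd a) := by
  induction a with
  | nil => simp
  | cons i a ih =>
    rw [wordProd_cons]
    exact (h i (by simp)).mul_right (ih fun u hu ↦ h u (by simp [hu]))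

theorem OccursFirst.isLeftDescent {cs : CoxeterSystem M W} {r : List B} {t : B}
    (hr : cs.IsReduced r) (h : cs.OccursFirst r t) : cs.IsLeftDescent (cs.wordProd r) t := by
  obtain ⟨a, b, rfl, h⟩ := h
  have hc := cs.commute_wordProd fun u hu ↦ (h u hu).2
  rw [IsLeftDescent, hr.eq, cs.wordProd_append_cons_of_commute hc, wordProd_cons,
    simple_mul_simple_cancel_left]
  refine (cs.length_wordProd_le _).trans_lt ?_
  simp

/-- In a reduced word, a left descent can be moved to the front using only commutations. -/
theorem occursFirst_of_isLeftDescent (hra : M.IsRightAngled) {r : List B} {t : B}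
    (hr : cs.IsReduced r) (h : cs.IsLeftDescent (cs.wordProd r) t) : cs.OccursFirst r t := by
  induction r with
  | nil => exact absurd h (by simpa using cs.not_isLeftDescent_one t)
  | cons u r ih =>
    by_cases hut : u = t
    · exact ⟨[], r, by simp [hut], by simp⟩
    have hr' : cs.IsReduced r := by simpa using hr.drop 1
    have hu : cs.IsLeftDescent (cs.wordProd (u :: r)) u :=
      OccursFirst.isLeftDescent hr ⟨[], r, rfl, by simp⟩
    have hc := cs.commute_of_isLeftDescent hra h hu
    obtain ⟨a, b, e, hca⟩ := cs.exchange hra h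
    cases a with
    | nil =>
      simp only [List.nil_append, List.cons.injEq] at e
      exact absurd e.1 hut
    | cons v a =>
      simp only [List.cons_append, List.cons.injEq] at e
      obtain ⟨rfl, rfl⟩ := e
      have hca' : Commute (cs.simple t) (cs.wordProd a) := by
        have := hc.mul_right hca
        rwa [wordProd_cons, simple_mul_simple_cancel_left] at this
      have hd : cs.IsLeftDescent (cs.wordProd (a ++ t :: b)) t := by
        rw [IsLeftDescent, hr'.eq, cs.wordProd_append_cons_of_commute hca', wordProd_cons,
          simple_mul_simple_cancel_left]
        refine (cs.length_wordProd_le _).trans_lt ?_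
        simp
      obtain ⟨a', b', e', h'⟩ := ih hr' hd
      refine ⟨u :: a', b', by simp [e'], ?_⟩
      intro v hv
      rcases List.mem_cons.mp hv with rfl | hv
      · exact ⟨hut, hc⟩
      · exact h' v hv

theorem occursFirst_cons_iff {u t : B} (hne : u ≠ t) {r : List B} :
    cs.OccursFirst (u :: r) t ↔ Commute (cs.simple t) (cs.simple u) ∧ cs.OccursFirst r t := by
  constructor
  · rintro ⟨a, b, e, h⟩
    cases a with
    | nil =>
      simp only [List.nil_append, List.cons.injEq] at e
      exact absurd e.1 hne
    | cons v a =>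
      simp only [List.cons_append, List.cons.injEq] at e
      obtain ⟨rfl, rfl⟩ := e
      exact ⟨(h u (by simp)).2, a, b, rfl, fun v hv ↦ h v (by simp [hv])⟩
  · rintro ⟨hc, a, b, rfl, h⟩
    refine ⟨u :: a, b, rfl, fun v hv ↦ ?_⟩
    rcases List.mem_cons.mp hv with rfl | hv
    · exact ⟨hne, hc⟩
    · exact h v hv

theorem occursFirst_append_singleton_iff {u t : B} (hne : u ≠ t) {r : List B} :
    cs.OccursFirst (r ++ [u]) t ↔ cs.OccursFirst r t := by
  constructor
  · rintro ⟨a, b, e, h⟩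
    rcases List.eq_nil_or_concat' b with rfl | ⟨b, v, rfl⟩
    · have := List.append_inj_right' e rfl
      simp only [List.cons.injEq, and_true] at this
      exact absurd this hne
    · refine ⟨a, b, ?_, h⟩
      rw [← List.cons_append, ← List.append_assoc] at e
      exact List.append_inj_left' e rfl
  · rintro ⟨a, b, rfl, h⟩
    exact ⟨a, b ++ [u], by simp, h⟩

theorem isLeftDescent_iff_occursFirst (hra : M.IsRightAngled) {r : List B}
    (hr : cs.IsReduced r) (t : B) :
    cs.IsLeftDescent (cs.wordProd r) t ↔ cs.OccursFirst r t :=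
  ⟨cs.occursFirst_of_isLeftDescent hra hr, OccursFirst.isLeftDescent hr⟩

theorem isRightDescent_iff_occursFirst_reverse (hra : M.IsRightAngled) {r : List B}
    (hr : cs.IsReduced r) (t : B) :
    cs.IsRightDescent (cs.wordProd r) t ↔ cs.OccursFirst r.reverse t := by
  rw [← cs.isLeftDescent_iff_occursFirst hra hr.reverse, wordProd_reverse, isLeftDescent_inv_iff]

theorem isReduced_cons_of_not_isLeftDescent {u : B} {r : List B} (hr : cs.IsReduced r)
    (h : ¬ cs.IsLeftDescent (cs.wordProd r) u) : cs.IsReduced (u :: r) := by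
  rw [not_isLeftDescent_iff] at h
  rw [IsReduced, wordProd_cons, h, hr.eq, List.length_cons]

/-- Every element has a reduced word `r` such that `u :: r` is reduced and represents either
`u * h` or `h`, according to whether `u` is a left descent of `h`. -/
theorem exists_isReduced_cons (u : B) (h : W) :
    ∃ r, cs.IsReduced (u :: r) ∧
      ((cs.wordProd r = h ∧ cs.simple u * h = cs.wordProd (u :: r)) ∨
        (cs.wordProd (u :: r) = h ∧ cs.simple u * h = cs.wordProd r)) := by
  by_cases hu : cs.IsLeftDescent h u
  · obtain ⟨r, hr, e⟩ := cs.exists_isReduced (cs.simple u * h)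
    refine ⟨r, cs.isReduced_cons_of_not_isLeftDescent hr ?_, Or.inr ⟨?_, e⟩⟩
    · rw [← e]
      exact cs.isLeftDescent_iff_not_isLeftDescent_mul.mp hu
    · rw [wordProd_cons, ← e, simple_mul_simple_cancel_left]
  · obtain ⟨r, hr, rfl⟩ := cs.exists_isReduced h
    exact ⟨r, cs.isReduced_cons_of_not_isLeftDescent hr hu,
      Or.inl ⟨rfl, (cs.wordProd_cons u r).symm⟩⟩

theorem isLeftDescent_simple_mul_iff (hra : M.IsRightAngled) {u t : B} (hne : u ≠ t)
    (hc : Commute (cs.simple t) (cs.simple u)) (h : W) :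
    cs.IsLeftDescent (cs.simple u * h) t ↔ cs.IsLeftDescent h t := by
  obtain ⟨r, hr, hh⟩ := cs.exists_isReduced_cons u h
  have hr' : cs.IsReduced r := by simpa using hr.drop 1
  have key := cs.occursFirst_cons_iff hne (r := r)
  rw [← cs.isLeftDescent_iff_occursFirst hra hr, ← cs.isLeftDescent_iff_occursFirst hra hr'] at key
  rcases hh with ⟨e₁, e₂⟩ | ⟨e₁, e₂⟩ <;> rw [e₂, ← e₁, key] <;> simp [hc]

theorem isRightDescent_simple_mul_iff (hra : M.IsRightAngled) {u t : B} (hne : u ≠ t) (h : W) :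
    cs.IsRightDescent (cs.simple u * h) t ↔ cs.IsRightDescent h t := by
  obtain ⟨r, hr, hh⟩ := cs.exists_isReduced_cons u h
  have hr' : cs.IsReduced r := by simpa using hr.drop 1
  have key := cs.occursFirst_append_singleton_iff hne (r := r.reverse)
  rw [← List.reverse_cons, ← cs.isRightDescent_iff_occursFirst_reverse hra hr,
    ← cs.isRightDescent_iff_occursFirst_reverse hra hr'] at key
  rcases hh with ⟨e₁, e₂⟩ | ⟨e₁, e₂⟩ <;> rw [e₂, ← e₁, key]

theorem isLeftDescent_wordProd_mul_iff (hra : M.IsRightAngled) {y : List B} {t : B}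
    (hy : ∀ u ∈ y, u ≠ t ∧ Commute (cs.simple t) (cs.simple u)) (h : W) :
    cs.IsLeftDescent (cs.wordProd y * h) t ↔ cs.IsLeftDescent h t := by
  induction y with
  | nil => simp
  | cons u y ih =>
    obtain ⟨hne, hc⟩ := hy u (by simp)
    rw [wordProd_cons, mul_assoc, cs.isLeftDescent_simple_mul_iff hra hne hc,
      ih fun v hv ↦ hy v (by simp [hv])]

theorem isRightDescent_wordProd_mul_iff (hra : M.IsRightAngled) {y : List B} {t : B}
    (hy : ∀ u ∈ y, u ≠ t) (h : W) :
    cs.IsRightDescent (cs.wordProd y * h) t ↔ cs.IsRightDescent h t := by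
  induction y with
  | nil => simp
  | cons u y ih =>
    rw [wordProd_cons, mul_assoc, cs.isRightDescent_simple_mul_iff hra (hy u (by simp)),
      ih fun v hv ↦ hy v (by simp [hv])]

/-- A generator missing from some word for an element is not a left descent of that element. -/
theorem not_isLeftDescent_of_notMem (hra : M.IsRightAngled) {r : List B} {t : B} (ht : t ∉ r) :
    ¬ cs.IsLeftDescent (cs.wordProd r) t := by
  classical
  have hl : M.IsLiftable (fun i ↦ if i = t then 1 else cs.simple i) := by
    refine isLiftable_of_isRightAngled hra _ (fun i ↦ ?_) (fun i j _ h ↦ ?_)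
    · split_ifs <;> simp
    · have := cs.commute_simple_of_eq_two h
      split_ifs <;> simp [this]
  have hf : ∀ l : List B, cs.lift ⟨_, hl⟩ (cs.wordProd l) =
      cs.wordProd (l.filter (· ≠ t)) := by
    intro l
    induction l with
    | nil => simp
    | cons i l ih =>
      rw [wordProd_cons, map_mul, ih, cs.lift_apply_simple]
      by_cases hi : i = t <;> simp [hi, wordProd_cons]
  intro h
  obtain ⟨r₀, hr₀, e⟩ := cs.exists_isReduced (cs.simple t * cs.wordProd r)
  have h1 := congrArg (cs.lift ⟨_, hl⟩) e
  rw [map_mul, cs.lift_apply_simple, hf, hf, List.filter_eq_self.mpr, if_pos rfl, one_mul] at h1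
  · rw [IsLeftDescent, e, hr₀.eq, h1] at h
    exact absurd (h.trans_le ((cs.length_wordProd_le _).trans (List.length_filter_le _ _)))
      (lt_irrefl _)
  · intro i hi
    simpa using fun h : i = t ↦ ht (h ▸ hi)

theorem not_isRightDescent_of_notMem (hra : M.IsRightAngled) {r : List B} {t : B} (ht : t ∉ r) :
    ¬ cs.IsRightDescent (cs.wordProd r) t := by
  rw [← isLeftDescent_inv_iff, ← wordProd_reverse]
  exact cs.not_isLeftDescent_of_notMem hra (by simpa using ht)

theorem IsReduced.sMinimal {cs : CoxeterSystem M W} {r : List B} (hr : cs.IsReduced r) (t : B) :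
    cs.SMinimal r t := by
  rintro l₁ l₂ l₃ rfl -
  by_contra! hb
  have hc : Commute (cs.simple t) (cs.wordProd l₂) :=
    cs.commute_wordProd fun u hu ↦ not_not.mp (hb u hu)
  have e : cs.wordProd (l₁ ++ t :: l₂ ++ t :: l₃) = cs.wordProd (l₁ ++ l₂ ++ l₃) := by
    rw [List.append_assoc, List.append_assoc, cs.wordProd_append, cs.wordProd_append l₁,
      List.cons_append, wordProd_cons, cs.wordProd_append_cons_of_commute hc, wordProd_cons,
      simple_mul_simple_cancel_left]
  have h1 := cs.length_wordProd_le (l₁ ++ l₂ ++ l₃)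
  rw [← e, hr.eq] at h1
  simp at h1

theorem IsReduced.exists_of_not_sGood {cs : CoxeterSystem M W} {r : List B} {t : B}
    (hr : cs.IsReduced r) (h : ¬ cs.SGood r t) :
    ∃ l₁ l₂ l₃, r = l₁ ++ t :: l₂ ++ t :: l₃ ∧
      (∀ u ∈ l₁, u ≠ t ∧ Commute (cs.simple t) (cs.simple u)) ∧
      ∀ u ∈ l₃, u ≠ t ∧ Commute (cs.simple t) (cs.simple u) := by
  rw [SGood, not_and] at h
  have h := h (hr.sMinimal t)
  push Not at h
  obtain ⟨l₁, l₂, l₃, e, h₁, h₃, hb⟩ := h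
  simp only [IsBlocker, not_not] at hb
  exact ⟨l₁, l₂, l₃, e, fun u hu ↦ ⟨fun h ↦ h₁ (h ▸ hu), hb u (by simp [hu])⟩,
    fun u hu ↦ ⟨fun h ↦ h₃ (h ▸ hu), hb u (by simp [hu])⟩⟩

theorem IsReduced.sGood_of_not_isLeftDescent {cs : CoxeterSystem M W} {r : List B} {t : B}
    (hr : cs.IsReduced r) (h : ¬ cs.IsLeftDescent (cs.wordProd r) t) : cs.SGood r t := by
  by_contra hg
  obtain ⟨l₁, l₂, l₃, e, h₁, -⟩ := hr.exists_of_not_sGood hg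
  exact h (OccursFirst.isLeftDescent hr ⟨l₁, l₂ ++ t :: l₃, by simp [e], h₁⟩)

theorem IsReduced.sGood_of_not_isRightDescent {cs : CoxeterSystem M W} {r : List B} {t : B}
    (hr : cs.IsReduced r) (h : ¬ cs.IsRightDescent (cs.wordProd r) t) : cs.SGood r t := by
  by_contra hg
  obtain ⟨l₁, l₂, l₃, e, -, h₃⟩ := hr.exists_of_not_sGood hg
  apply h
  rw [← isLeftDescent_inv_iff, ← wordProd_reverse]
  exact OccursFirst.isLeftDescent hr.reverse
    ⟨l₃.reverse, (l₁ ++ t :: l₂).reverse, by simp [e], by simpa using h₃⟩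

/-- Multiplying on the left by letters that commute with `t` preserves `t`-goodness of reduced
words. -/
theorem sGood_of_wordProd_eq_mul (hra : M.IsRightAngled) {y w r : List B} {t : B}
    (hy : ∀ u ∈ y, u ≠ t ∧ Commute (cs.simple t) (cs.simple u)) (hw : cs.IsReduced w)
    (hr : cs.IsReduced r) (e : cs.wordProd r = cs.wordProd y * cs.wordProd w)
    (hg : cs.SGood w t) : cs.SGood r t := by
  by_contra hn
  have hl : cs.IsLeftDescent (cs.wordProd w) t := by
    rw [← cs.isLeftDescent_wordProd_mul_iff hra hy, ← e]
    exact not_not.mp fun h ↦ hn (hr.sGood_of_not_isLeftDescent h)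
  have hrt : cs.IsRightDescent (cs.wordProd w) t := by
    rw [← cs.isRightDescent_wordProd_mul_iff hra fun u hu ↦ (hy u hu).1, ← e]
    exact not_not.mp fun h ↦ hn (hr.sGood_of_not_isRightDescent h)
  obtain ⟨a, b, hab, ha⟩ := (cs.isLeftDescent_iff_occursFirst hra hw t).mp hl
  obtain ⟨d, c, hcd, hd⟩ := (cs.isRightDescent_iff_occursFirst_reverse hra hw t).mp hrt
  have hcd : w = c.reverse ++ t :: d.reverse := by
    rw [← w.reverse_reverse, hcd]
    simp
  have hcases : b = d.reverse ∨ ∃ m, b = m ++ t :: d.reverse := by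
    rcases List.append_eq_append_iff.mp (hab.symm.trans hcd) with ⟨x, -, h⟩ | ⟨x, hx, h⟩
    · rcases x with _ | ⟨v, m⟩
      · simp_all
      · simp only [List.cons_append, List.cons.injEq] at h
        exact Or.inr ⟨m, h.2⟩
    · rcases x with _ | ⟨v, m⟩
      · simp_all
      · simp only [List.cons_append, List.cons.injEq] at h
        exact absurd rfl (ha t (by simp [hx, h.1])).1
  rcases hcases with rfl | ⟨m, rfl⟩
  · have hcw : Commute (cs.simple t) (cs.wordProd w) := by
      refine cs.commute_wordProd fun u hu ↦ ?_
      rw [hab] at hu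
      rcases List.mem_append.mp hu with hu | hu
      · exact (ha u hu).2
      · rcases List.mem_cons.mp hu with rfl | hu
        · exact Commute.refl _
        · exact (hd u (by simpa using hu)).2
    have hcr : Commute (cs.simple t) (cs.wordProd r) := by
      rw [e]
      exact (cs.commute_wordProd fun u hu ↦ (hy u hu).2).mul_right hcw
    obtain ⟨l₁, l₂, l₃, rfl, h₁, h₃⟩ := hr.exists_of_not_sGood hn
    have c₁ := cs.commute_wordProd fun u hu ↦ (h₁ u hu).2
    have c₃ := cs.commute_wordProd fun u hu ↦ (h₃ u hu).2
    have e₁ : cs.wordProd (l₁ ++ t :: l₂ ++ t :: l₃) =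
        cs.simple t * cs.wordProd (l₁ ++ l₂ ++ l₃) * cs.simple t := by
      rw [List.append_assoc, List.cons_append, cs.wordProd_append_cons_of_commute c₁]
      simp only [wordProd_cons, wordProd_append, mul_assoc, c₃.eq]
    have e₂ : cs.wordProd (l₁ ++ t :: l₂ ++ t :: l₃) = cs.wordProd (l₁ ++ l₂ ++ l₃) := by
      have h := hcr.eq
      rw [e₁] at h
      have h' := congrArg (fun x ↦ x * cs.simple t) h
      rw [e₁]
      simpa [mul_assoc] using h'.symm
    have h1 := cs.length_wordProd_le (l₁ ++ l₂ ++ l₃)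
    rw [← e₂, hr.eq] at h1
    simp at h1
  · obtain ⟨u, hu, hb⟩ := hg.2 a m d.reverse (by simp [hab])
      (fun h ↦ (ha t h).1 rfl) (fun h ↦ (hd t (by simpa using h)).1 rfl)
    rcases List.mem_append.mp hu with hu | hu
    · exact hb (hd u (by simpa using hu)).2
    · exact hb (ha u hu).2

theorem not_isLeftDescent_of_not_commute (hra : M.IsRightAngled) {t u : B} {g : W}
    (ht : cs.IsLeftDescent g t) (h : ¬ Commute (cs.simple t) (cs.simple u)) :
    ¬ cs.IsLeftDescent g u :=
  fun hu ↦ h (cs.commute_of_isLeftDescent hra ht hu)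

theorem isLeftDescent_simple_mul_self {u : B} {g : W} (h : ¬ cs.IsLeftDescent g u) :
    cs.IsLeftDescent (cs.simple u * g) u := by
  rwa [isLeftDescent_iff_not_isLeftDescent_mul, simple_mul_simple_cancel_left]

/-- If `t` does not commute with `u`, then prepending `u` to an element with left descent `t`
yields an element with left descent `u`. -/
theorem isLeftDescent_simple_mul_of_not_commute (hra : M.IsRightAngled) {t u : B} {g : W}
    (ht : cs.IsLeftDescent g t) (h : ¬ Commute (cs.simple t) (cs.simple u)) :
    cs.IsLeftDescent (cs.simple u * g) u :=
  cs.isLeftDescent_simple_mul_self (cs.not_isLeftDescent_of_not_commute hra ht h)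

section Block

variable {s s' s'' : B}

theorem isLeftDescent_mul_mul (hra : M.IsRightAngled) (hne : s'' ≠ s)
    (hs' : ¬ Commute (cs.simple s) (cs.simple s'))
    (hs'' : ¬ Commute (cs.simple s') (cs.simple s'')) {z : W} (hz : cs.IsLeftDescent z s) :
    cs.IsLeftDescent (cs.simple s' * (cs.simple s'' * z)) s' := by
  by_cases hc : Commute (cs.simple s) (cs.simple s'')
  · exact cs.isLeftDescent_simple_mul_of_not_commute hra
      ((cs.isLeftDescent_simple_mul_iff hra hne hc z).mpr hz) hs'
  · exact cs.isLeftDescent_simple_mul_of_not_commute hra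
      (cs.isLeftDescent_simple_mul_of_not_commute hra hz hc) fun h ↦ hs'' h.symm

theorem wordProd_block_mul (z : W) : cs.wordProd [s', s'', s, s', s''] * z =
    cs.simple s' * (cs.simple s'' * (cs.simple s * (cs.simple s' * (cs.simple s'' * z)))) := by
  simp [wordProd_cons, mul_assoc]

theorem isLeftDescent_block_mul (hra : M.IsRightAngled) (hne : s'' ≠ s)
    (hs' : ¬ Commute (cs.simple s) (cs.simple s'))
    (hs'' : ¬ Commute (cs.simple s') (cs.simple s'')) {z : W} (hz : cs.IsLeftDescent z s') :
    cs.IsLeftDescent (cs.wordProd [s', s'', s, s', s''] * z) s' := by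
  have h₁ := cs.isLeftDescent_simple_mul_of_not_commute hra hz hs''
  have h₂ := cs.isLeftDescent_simple_mul_of_not_commute hra h₁ fun h ↦ hs'' h.symm
  have h₃ := cs.isLeftDescent_simple_mul_of_not_commute hra h₂ fun h ↦ hs' h.symm
  rw [wordProd_block_mul]
  exact cs.isLeftDescent_mul_mul hra hne hs' hs'' h₃

theorem isLeftDescent_block_pow_mul (hra : M.IsRightAngled) (hne : s'' ≠ s)
    (hs' : ¬ Commute (cs.simple s) (cs.simple s'))
    (hs'' : ¬ Commute (cs.simple s') (cs.simple s'')) {w : List B} (hw : s ∉ w) (n : ℕ) :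
    cs.IsLeftDescent (cs.wordProd [s', s'', s, s', s''] ^ (n + 1) * cs.wordProd w) s' := by
  have hne' : s ≠ s' := by
    rintro rfl
    exact hs' (Commute.refl _)
  induction n with
  | zero =>
    have h : ¬ cs.IsLeftDescent (cs.wordProd (s' :: s'' :: w)) s :=
      cs.not_isLeftDescent_of_notMem hra (by simp [hne', hne.symm, hw])
    rw [zero_add, pow_one, wordProd_block_mul, ← wordProd_cons, ← wordProd_cons]
    exact cs.isLeftDescent_mul_mul hra hne hs' hs'' (cs.isLeftDescent_simple_mul_self h)
  | succ n ih =>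
    rw [pow_succ', mul_assoc]
    exact cs.isLeftDescent_block_mul hra hne hs' hs'' ih

theorem commute_of_isLeftDescent_block_mul (hra : M.IsRightAngled) (hne : s'' ≠ s)
    (hs' : ¬ Commute (cs.simple s) (cs.simple s'))
    (hs'' : ¬ Commute (cs.simple s') (cs.simple s'')) {z : W} (hz : cs.IsLeftDescent z s')
    {t : B} (ht' : t ≠ s') (ht'' : t ≠ s'')
    (ht : cs.IsLeftDescent (cs.wordProd [s', s'', s, s', s''] * z) t) :
    ∀ u ∈ [s', s'', s, s', s''], Commute (cs.simple t) (cs.simple u) := by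
  have c' := cs.commute_of_isLeftDescent hra ht (cs.isLeftDescent_block_mul hra hne hs' hs'' hz)
  have h₁ := cs.isLeftDescent_simple_mul_of_not_commute hra hz hs''
  have h₂ := cs.isLeftDescent_simple_mul_of_not_commute hra h₁ fun h ↦ hs'' h.symm
  have h₃ := cs.isLeftDescent_simple_mul_of_not_commute hra h₂ fun h ↦ hs' h.symm
  rw [wordProd_block_mul] at ht
  have ht₄ := (cs.isLeftDescent_simple_mul_iff hra ht'.symm c' _).mp ht
  have c'' : Commute (cs.simple t) (cs.simple s'') := by
    refine cs.commute_of_isLeftDescent hra ht₄ (cs.isLeftDescent_simple_mul_self ?_)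
    by_cases hc : Commute (cs.simple s'') (cs.simple s)
    · rw [cs.isLeftDescent_simple_mul_iff hra hne.symm hc]
      exact cs.not_isLeftDescent_of_not_commute hra h₂ hs''
    · exact cs.not_isLeftDescent_of_not_commute hra h₃ fun h ↦ hc h.symm
  have c := cs.commute_of_isLeftDescent hra
    ((cs.isLeftDescent_simple_mul_iff hra ht''.symm c'' _).mp ht₄) h₃
  intro u hu
  simp only [List.mem_cons, List.not_mem_nil, or_false] at hu
  rcases hu with rfl | rfl | rfl | rfl | rfl <;> assumption

end Block

theorem sGood_of_wordProd_eq_simple_mul (hra : M.IsRightAngled) {w r : List B} {s : B}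
    (hs : s ∉ w) (hr : cs.IsReduced r)
    (e : cs.wordProd r = cs.simple s * cs.wordProd w) : cs.SGood r s := by
  by_contra hn
  obtain ⟨l₁, l₂, l₃, rfl, h₁, h₃⟩ := hr.exists_of_not_sGood hn
  have c₁ := cs.commute_wordProd fun u hu ↦ (h₁ u hu).2
  have e₁ : cs.wordProd w = cs.wordProd (l₁ ++ (l₂ ++ s :: l₃)) := by
    rw [List.append_assoc, List.cons_append, cs.wordProd_append_cons_of_commute c₁,
      wordProd_cons] at e
    exact (mul_left_cancel e).symm
  have hl := cs.not_isLeftDescent_iff.mp (cs.not_isLeftDescent_of_notMem hra hs)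
  have hred : cs.IsReduced (l₁ ++ (l₂ ++ s :: l₃)) := by
    rw [← e, hr.eq] at hl
    rw [IsReduced, ← e₁]
    simp at hl ⊢
    lia
  apply cs.not_isRightDescent_of_notMem hra hs
  rw [e₁, cs.isRightDescent_iff_occursFirst_reverse hra hred]
  exact ⟨l₃.reverse, (l₁ ++ l₂).reverse, by simp, by simpa using h₃⟩

theorem wordProd_flatten_replicate (n : ℕ) (r : List B) :
    cs.wordProd (List.replicate n r).flatten = cs.wordProd r ^ n := by
  induction n with
  | zero => simp
  | succ n ih => rw [List.replicate_succ, List.flatten_cons, wordProd_append, ih, pow_succ']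

end CoxeterSystem

/-- Lemma on words missing a generator, second case. Let `T ⊴ W` be a proper normal
subgroup of finite index `n ≥ 2` of an infinite, irreducible, non-affine right-angled
Coxeter group, and let `w` be a reduced word representing an element of `T` in which
`s` does not occur, where `ss' ≠ s's` and `s's'' ≠ s''s'`. Then `(s's''ss's'')ⁿ w`
represents an element of `T`, and any reduced expression `r'` of it is `s`-good and
`s''`-good; moreover, for `t ∉ {s, s', s''}`, if `w` is `t`-good then so is `r'`. -/
theorem stmt_11 {B W : Type*} [Fintype B] [Group W] {M : CoxeterMatrix B}
    (cs : CoxeterSystem M W) (hra : M.IsRightAngled) [Infinite W]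
    (hirr : cs.IsIrreducible) (hnaff : ¬ IsVirtuallyFreeAbelian W)
    (T : Subgroup W) [T.Normal] (hTproper : T ≠ ⊤)
    (n : ℕ) (hn : T.index = n) (hn2 : 2 ≤ n)
    (w : List B) (hw : cs.ReducedWord w) (hwT : cs.wordProd w ∈ T)
    (s s' s'' : B) (hs : s ∉ w)
    (hs' : ¬ Commute (cs.simple s) (cs.simple s'))
    (hs'' : ¬ Commute (cs.simple s') (cs.simple s'')) :
    cs.wordProd (List.flatten (List.replicate n [s', s'', s, s', s'']) ++ w) ∈ T ∧
      ∀ r' : List B, cs.ReducedWord r' →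
        cs.wordProd r' = cs.wordProd (List.flatten (List.replicate n [s', s'', s, s', s'']) ++ w) →
          cs.SGood r' s ∧ cs.SGood r' s'' ∧
            ∀ t : B, t ≠ s → t ≠ s' → t ≠ s'' → cs.SGood w t → cs.SGood r' t := by
  subst hn
  have hwr := (cs.reducedWord_iff_isReduced w).mp hw
  rw [cs.wordProd_append, cs.wordProd_flatten_replicate]
  refine ⟨T.mul_mem (T.pow_index_mem _) hwT, fun r' hr' e ↦ ?_⟩
  rw [cs.reducedWord_iff_isReduced] at hr'
  by_cases hne : s'' = s
  · subst hne
    have hblock : cs.wordProd [s', s'', s'', s', s''] = cs.simple s'' := by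
      simp [CoxeterSystem.wordProd_cons]
    rw [hblock] at e
    rcases Nat.even_or_odd T.index with hp | hp
    · have hpow : cs.simple s'' ^ T.index = 1 := by
        obtain ⟨m, hm⟩ := hp
        rw [hm, ← two_mul, pow_mul, cs.simple_sq, one_pow]
      rw [hpow] at e
      have hgood : cs.SGood r' s'' := by
        apply hr'.sGood_of_not_isLeftDescent
        rw [e, one_mul]
        exact cs.not_isLeftDescent_of_notMem hra hs
      exact ⟨hgood, hgood, fun t _ _ _ hg ↦
        cs.sGood_of_wordProd_eq_mul hra (y := []) (by simp) hwr hr' (by simpa using e) hg⟩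
    · have hpow : cs.simple s'' ^ T.index = cs.simple s'' := by
        obtain ⟨m, hm⟩ := hp
        rw [hm, pow_succ, pow_mul, cs.simple_sq, one_pow, one_mul]
      rw [hpow] at e
      have hgood := cs.sGood_of_wordProd_eq_simple_mul hra hs hr' e
      refine ⟨hgood, hgood, fun t ht _ _ hg ↦ ?_⟩
      by_cases hc : Commute (cs.simple t) (cs.simple s'')
      · exact cs.sGood_of_wordProd_eq_mul hra (y := [s'']) (by simp [hc, ht.symm]) hwr hr'
          (by simpa using e) hg
      · apply hr'.sGood_of_not_isLeftDescent
        rw [e]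
        exact cs.not_isLeftDescent_of_not_commute hra
          (cs.isLeftDescent_simple_mul_self (cs.not_isLeftDescent_of_notMem hra hs))
          fun h ↦ hc h.symm
  · obtain ⟨m, hm⟩ : ∃ m, T.index = m + 1 + 1 := ⟨T.index - 2, by lia⟩
    have hd := cs.isLeftDescent_block_pow_mul hra hne hs' hs'' hs (m + 1)
    rw [← hm, ← e] at hd
    refine ⟨hr'.sGood_of_not_isLeftDescent
        (cs.not_isLeftDescent_of_not_commute hra hd fun h ↦ hs' h.symm),
      hr'.sGood_of_not_isLeftDescent (cs.not_isLeftDescent_of_not_commute hra hd hs''),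
      fun t ht ht' ht'' hg ↦ ?_⟩
    by_contra hn
    have htd : cs.IsLeftDescent (cs.wordProd r') t :=
      not_not.mp fun h ↦ hn (hr'.sGood_of_not_isLeftDescent h)
    rw [e, hm, pow_succ', mul_assoc] at htd
    have hc := cs.commute_of_isLeftDescent_block_mul hra hne hs' hs''
      (cs.isLeftDescent_block_pow_mul hra hne hs' hs'' hs m) ht' ht'' htd
    refine hn (cs.sGood_of_wordProd_eq_mul hra
      (y := (List.replicate T.index [s', s'', s, s', s'']).flatten) (fun u hu ↦ ?_) hwr hr'
      (by rw [e, cs.wordProd_flatten_replicate]) hg)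
    obtain ⟨l, hl, hu⟩ := List.mem_flatten.mp hu
    rw [List.eq_of_mem_replicate hl] at hu
    refine ⟨?_, hc u hu⟩
    simp only [List.mem_cons, List.not_mem_nil, or_false] at hu
    rcases hu with rfl | rfl | rfl | rfl | rfl
    exacts [ht'.symm, ht''.symm, ht.symm, ht'.symm, ht''.symm]
end

section
/- Let (W,S) be an infinite, irreducible, non-affine right-angled Coxeter system with S finite, and let T be a proper normal subgroup of W of finite index. Then for every subset B ⊆ S there exists a word v over S representing an element of T (a B-cancellator) such that for every reduced word w over S representing an element of T, in which every generator of S occurs and with B(w) = B, every reduced word over S representing the element of vw is s-good for all s ∈ S. -/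
/-! ### Combinatorics of words over a set with a symmetric irreflexive "blocking" relation -/

namespace BlockedWord

variable {B : Type*} {R : B → B → Prop}

/-- Some occurrence of `s` in the word can be moved to the front. -/
def Fronts (R : B → B → Prop) : List B → B → Prop
  | [], _ => False
  | a :: l, s => a = s ∨ (¬ R s a ∧ Fronts R l s)

/-- No two equal letters of the word can be moved next to each other. -/
def Minimal (R : B → B → Prop) : List B → Prop
  | [] => True
  | a :: l => Minimal R l ∧ ¬ Fronts R l a

theorem Fronts.mem {l : List B} {s : B} (h : Fronts R l s) : s ∈ l := by
  induction l with
  | nil => exact h.elim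
  | cons a l ih =>
    rcases h with rfl | ⟨_, h⟩
    · simp
    · exact List.mem_cons_of_mem _ (ih h)

theorem fronts_append {l m : List B} {s : B} :
    Fronts R (l ++ m) s ↔ Fronts R l s ∨ ((∀ a ∈ l, ¬ R s a) ∧ Fronts R m s) := by
  induction l with
  | nil => simp [Fronts]
  | cons a l ih =>
    simp only [List.cons_append, Fronts, ih, List.forall_mem_cons]
    tauto

theorem not_rel_of_fronts (hirr : ∀ a, ¬ R a a) (hsymm : ∀ a b, R a b → R b a)
    {l : List B} {s t : B} (hs : Fronts R l s) (ht : Fronts R l t) : ¬ R s t := by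
  induction l with
  | nil => exact hs.elim
  | cons a l ih =>
    rcases hs with rfl | ⟨hs, hs'⟩ <;> rcases ht with rfl | ⟨ht, ht'⟩
    · exact hirr _
    · exact fun h => ht (hsymm _ _ h)
    · exact hs
    · exact ih hs' ht'

theorem minimal_append {l m : List B} :
    Minimal R (l ++ m) ↔
      Minimal R l ∧ Minimal R m ∧ ∀ s, Fronts R l.reverse s → ¬ Fronts R m s := by
  induction l with
  | nil => simp [Minimal, Fronts]
  | cons a l ih =>
    simp only [List.cons_append, Minimal, ih, List.reverse_cons, fronts_append, Fronts,
      List.mem_reverse, not_or]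
    constructor
    · rintro ⟨⟨hl, hm, h⟩, hla, hma⟩
      refine ⟨⟨hl, hla⟩, hm, ?_⟩
      rintro s (hs | ⟨hs, rfl | hs'⟩)
      · exact h s hs
      · exact fun hf => hma ⟨hs, hf⟩
      · exact hs'.2.elim
    · rintro ⟨⟨hl, hla⟩, hm, h⟩
      exact ⟨⟨hl, hm, fun s hs => h s (Or.inl hs)⟩, hla,
        fun ⟨h₁, h₂⟩ => h a (Or.inr ⟨h₁, Or.inl rfl⟩) h₂⟩

theorem Minimal.reverse {l : List B} (h : Minimal R l) : Minimal R l.reverse := by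
  induction l with
  | nil => exact h
  | cons a l ih =>
    rw [List.reverse_cons, minimal_append]
    refine ⟨ih h.1, ⟨trivial, id⟩, ?_⟩
    rw [List.reverse_reverse]
    rintro s hs (rfl | hs')
    · exact h.2 hs
    · exact hs'.2

theorem fronts_of_isChain (hsymm : ∀ a b, R a b → R b a) {l : List B} {a s : B}
    (hl : (a :: l).IsChain R) (hs : Fronts R (a :: l) s) : s = a := by
  induction l generalizing a with
  | nil =>
    rcases hs with rfl | hs
    · rfl
    · exact hs.2.elim
  | cons b l ih =>
    rw [List.isChain_cons_cons] at hl
    rcases hs with rfl | ⟨h, hs⟩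
    · rfl
    · obtain rfl := ih hl.2 hs
      exact (h (hsymm _ _ hl.1)).elim

theorem minimal_of_isChain (hirr : ∀ a, ¬ R a a) (hsymm : ∀ a b, R a b → R b a)
    {l : List B} (hl : l.IsChain R) : Minimal R l := by
  induction l with
  | nil => trivial
  | cons a l ih =>
    refine ⟨ih hl.tail, fun h => ?_⟩
    cases l with
    | nil => exact h
    | cons b l =>
      obtain rfl := fronts_of_isChain hsymm hl.tail h
      exact hirr _ (List.isChain_cons_cons.1 hl).1

/-! #### Action on families of two-letter projections -/

/-- The unordered pair `e` consists of `s` and a letter blocking `s`. -/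
def Touches (R : B → B → Prop) (s : B) (e : Sym2 B) : Prop := ∃ t, R s t ∧ e = s(s, t)

open Classical in
/-- The number of leading letters `s` of a word. -/
noncomputable def lead (s : B) : List B → ℕ
  | [] => 0
  | a :: l => if a = s then lead s l + 1 else 0

theorem eq_cons_tail_of_lead_pos {s : B} {l : List B} (h : 0 < lead s l) :
    l = s :: l.tail ∧ lead s l = lead s l.tail + 1 := by
  cases l with
  | nil => simp [lead] at h
  | cons a l =>
    by_cases ha : a = s
    · subst ha; simp [lead]
    · simp [lead, ha] at h

/-- The largest `n` such that all the words `x e`, with `e` touched by `s`, start with `s ^ n`. -/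
noncomputable def height (R : B → B → Prop) (s : B) (x : Sym2 B → List B) : ℕ :=
  ⨅ e : {e // Touches R s e}, lead s (x e)

theorem height_eq {s : B} {x : Sym2 B → List B} {n : ℕ}
    (h : ∃ e, Touches R s e ∧ lead s (x e) = n)
    (h' : ∀ e, Touches R s e → n ≤ lead s (x e)) : height R s x = n := by
  obtain ⟨e, he, rfl⟩ := h
  have : Nonempty {e // Touches R s e} := ⟨⟨e, he⟩⟩
  exact le_antisymm (ciInf_le (OrderBot.bddBelow _) (⟨e, he⟩ : {e // Touches R s e}))
    (le_ciInf fun u => h' u u.2)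

theorem height_le {s : B} {e : Sym2 B} (x : Sym2 B → List B) (he : Touches R s e) :
    height R s x ≤ lead s (x e) :=
  ciInf_le (OrderBot.bddBelow _) (⟨e, he⟩ : {e // Touches R s e})

theorem exists_lead_eq_height (hR : ∀ s, ∃ t, R s t) (s : B) (x : Sym2 B → List B) :
    ∃ e, Touches R s e ∧ lead s (x e) = height R s x := by
  obtain ⟨t, ht⟩ := hR s
  have : Nonempty {e // Touches R s e} := ⟨⟨_, t, ht, rfl⟩⟩
  obtain ⟨e, he⟩ :=
    Nat.sInf_mem (Set.range_nonempty fun e : {e // Touches R s e} => lead s (x e))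
  exact ⟨e, e.2, he⟩

open Classical in
/-- The action of the generator `s` on families of two-letter words: `s` is removed from the front
of all the words it touches if their common power of `s` is odd, and is added otherwise. -/
noncomputable def toggle (R : B → B → Prop) (s : B) (x : Sym2 B → List B) : Sym2 B → List B :=
  fun e => if Touches R s e then
    (if Even (height R s x) then s :: x e else (x e).tail) else x e

theorem height_toggle_of_even (hR : ∀ s, ∃ t, R s t) {s : B} {x : Sym2 B → List B}
    (h : Even (height R s x)) : height R s (toggle R s x) = height R s x + 1 := by
  obtain ⟨e, he, hx⟩ := exists_lead_eq_height hR s x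
  refine height_eq ⟨e, he, ?_⟩ fun e he => ?_
  · simp [toggle, he, h, lead, hx]
  · simpa [toggle, he, h, lead] using height_le x he

theorem height_toggle_of_not_even (hR : ∀ s, ∃ t, R s t) {s : B} {x : Sym2 B → List B}
    (h : ¬ Even (height R s x)) : height R s (toggle R s x) = height R s x - 1 := by
  have hpos : 0 < height R s x := Nat.pos_of_ne_zero fun h0 => h (by simp [h0])
  obtain ⟨e, he, hx⟩ := exists_lead_eq_height hR s x
  refine height_eq ⟨e, he, ?_⟩ fun e he => ?_
  · have := (eq_cons_tail_of_lead_pos (hx ▸ hpos)).2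
    simp only [toggle, he, h, if_true, if_false]
    omega
  · have hle := height_le x he
    have := (eq_cons_tail_of_lead_pos (hpos.trans_le hle)).2
    simp only [toggle, he, h, if_true, if_false]
    omega

theorem toggle_involutive (hR : ∀ s, ∃ t, R s t) (s : B) :
    Function.Involutive (toggle R s) := by
  intro x
  funext e
  by_cases he : Touches R s e
  · by_cases h : Even (height R s x)
    · have h' : ¬ Even (height R s (toggle R s x)) := by
        rw [height_toggle_of_even hR h, Nat.even_add_one]
        exact not_not.2 h
      rw [toggle, if_pos he, if_neg h', toggle, if_pos he, if_pos h, List.tail_cons]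
    · have hpos : 0 < height R s x := Nat.pos_of_ne_zero fun h0 => h (by simp [h0])
      have h' : Even (height R s (toggle R s x)) := by
        rw [height_toggle_of_not_even hR h]
        exact Nat.Odd.sub_odd (Nat.not_even_iff_odd.1 h) odd_one
      rw [toggle, if_pos he, if_pos h', toggle, if_pos he, if_neg h]
      exact (eq_cons_tail_of_lead_pos (hpos.trans_le (height_le x he))).1.symm
  · simp [toggle, he]

theorem not_touches_of_touches {s t : B} (hst : s ≠ t) (h : ¬ R s t) {e : Sym2 B}
    (he : Touches R s e) : ¬ Touches R t e := by
  obtain ⟨a, ha, rfl⟩ := he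
  rintro ⟨b, hb, hab⟩
  rcases Sym2.eq_iff.1 hab with ⟨h1, -⟩ | ⟨-, h2⟩
  · exact hst h1
  · exact h (h2 ▸ ha)

theorem height_toggle_of_not_rel {s t : B} (hst : s ≠ t) (h : ¬ R s t) (x : Sym2 B → List B) :
    height R s (toggle R t x) = height R s x := by
  refine iInf_congr fun e => ?_
  rw [toggle, if_neg (not_touches_of_touches hst h e.2)]

theorem toggle_comm (hsymm : ∀ a b, R a b → R b a) {s t : B} (h : ¬ R s t)
    (x : Sym2 B → List B) : toggle R s (toggle R t x) = toggle R t (toggle R s x) := by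
  rcases eq_or_ne s t with rfl | hst
  · rfl
  have h' : ¬ R t s := fun h' => h (hsymm _ _ h')
  funext e
  by_cases hs : Touches R s e
  · have ht := not_touches_of_touches hst h hs
    have h₁ (y : Sym2 B → List B) : toggle R t y e = y e := if_neg ht
    rw [h₁, toggle, if_pos hs, height_toggle_of_not_rel hst h, h₁, toggle, if_pos hs]
  · have h₁ (y : Sym2 B → List B) : toggle R s y e = y e := if_neg hs
    by_cases ht : Touches R t e
    · rw [h₁, toggle, toggle, if_pos ht, if_pos ht, height_toggle_of_not_rel hst.symm h', h₁]
    · have h₂ (y : Sym2 B → List B) : toggle R t y e = y e := if_neg ht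
      rw [h₁, h₂, h₂, h₁]

open Classical in
/-- The family of two-letter projections of a word. -/
noncomputable def proj (R : B → B → Prop) (l : List B) (e : Sym2 B) : List B :=
  l.filter fun a => Touches R a e

theorem fronts_iff_lead_pos (hR : ∀ s, ∃ t, R s t) (hsymm : ∀ a b, R a b → R b a)
    {l : List B} {s : B} :
    Fronts R l s ↔ ∀ e, Touches R s e → 0 < lead s (proj R l e) := by
  induction l with
  | nil =>
    obtain ⟨t, ht⟩ := hR s
    simp only [Fronts, false_iff, not_forall]
    exact ⟨_, ⟨t, ht, rfl⟩, by simp [proj, lead]⟩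
  | cons a l ih =>
    rcases eq_or_ne a s with rfl | has
    · simp only [Fronts, true_or, true_iff]
      intro e he
      simp [proj, he, lead]
    · by_cases hsa : R s a
      · simp only [Fronts, has, hsa, not_true, false_and, or_false, false_iff, not_forall]
        refine ⟨s(s, a), ⟨a, hsa, rfl⟩, ?_⟩
        have : Touches R a s(s, a) := ⟨s, hsymm _ _ hsa, Sym2.eq_swap⟩
        simp [proj, this, lead, has]
      · simp only [Fronts, has, hsa, not_false_iff, true_and, false_or, ih]
        refine forall₂_congr fun e he => ?_
        have : ¬ Touches R a e := not_touches_of_touches has.symm hsa he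
        simp [proj, this]

theorem toggle_proj (hR : ∀ s, ∃ t, R s t) (hsymm : ∀ a b, R a b → R b a) {l : List B} {s : B}
    (h : ¬ Fronts R l s) : toggle R s (proj R l) = proj R (s :: l) := by
  have h0 : height R s (proj R l) = 0 := by
    rw [fronts_iff_lead_pos hR hsymm] at h
    push Not at h
    obtain ⟨e, he, h⟩ := h
    exact Nat.le_zero.1 ((height_le _ he).trans h)
  funext e
  by_cases he : Touches R s e <;> simp [toggle, he, h0, proj]

theorem foldr_toggle (hR : ∀ s, ∃ t, R s t) (hsymm : ∀ a b, R a b → R b a) {l : List B}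
    (hl : Minimal R l) : l.foldr (toggle R) (fun _ => []) = proj R l := by
  induction l with
  | nil => rfl
  | cons a l ih => rw [List.foldr_cons, ih hl.1, toggle_proj hR hsymm hl.2]

/-! #### Chains -/

theorem exists_isChain {y z : B} (h : Relation.ReflTransGen R y z) :
    ∃ l : List B, (y :: l).IsChain R ∧ (y :: l).getLast? = some z := by
  obtain ⟨l, hl, hz⟩ := List.exists_isChain_cons_of_relationReflTransGen h
  exact ⟨l, hl, by rw [← hz, List.getLast?_eq_getLast_of_ne_nil]⟩

theorem exists_isChain_supset (hconn : ∀ a b, Relation.ReflTransGen R a b) (y z : B)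
    (m : List B) : ∃ l : List B, (y :: l).IsChain R ∧ (y :: l).getLast? = some z ∧
      ∀ b ∈ m, b ∈ y :: l := by
  induction m generalizing y with
  | nil =>
    obtain ⟨l, h⟩ := exists_isChain (hconn y z)
    exact ⟨l, h.1, h.2, by simp⟩
  | cons b m ih =>
    obtain ⟨l₁, h₁, h₁'⟩ := exists_isChain (hconn y b)
    obtain ⟨l₂, h₂, h₂', h₂''⟩ := ih b
    refine ⟨l₁ ++ l₂, ?_, ?_, ?_⟩
    · rw [← List.cons_append]
      refine h₁.append h₂.tail ?_
      cases l₂ with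
      | nil => simp
      | cons c l₂ => simpa [h₁'] using (List.isChain_cons_cons.1 h₂).1
    · rw [← List.cons_append, List.getLast?_append, h₁']
      rw [List.getLast?_cons] at h₂'
      cases h : l₂.getLast? <;> simp_all
    · have hb : b ∈ y :: l₁ := List.mem_of_getLast? h₁'
      rw [← List.cons_append]
      simp only [List.mem_append]
      rw [List.forall_mem_cons]
      refine ⟨Or.inl hb, fun c hc => ?_⟩
      rcases List.mem_cons.1 (h₂'' c hc) with rfl | h
      · exact Or.inl hb
      · exact Or.inr h

theorem isChain_flatten_replicate {l : List B} {y z : B} (hl : (y :: l).IsChain R)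
    (hz : (y :: l).getLast? = some z) (hzy : R z y) (n : ℕ) :
    ∃ l', (List.replicate (n + 1) (y :: l)).flatten = y :: l' ∧ (y :: l').IsChain R ∧
      (y :: l').getLast? = some z := by
  induction n with
  | zero => exact ⟨l, by simp, hl, hz⟩
  | succ n ih =>
    obtain ⟨l', h, h₁, h₂⟩ := ih
    refine ⟨l ++ y :: l', ?_, ?_, ?_⟩
    · rw [List.replicate_succ, List.flatten_cons, h]; rfl
    · rw [← List.cons_append]
      refine hl.append h₁ ?_
      simp_all
    · rw [← List.cons_append, List.getLast?_append, h₂]; rfl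

theorem eq_of_fronts_reverse (hsymm : ∀ a b, R a b → R b a) {l : List B} {z s : B}
    (hl : l.IsChain R) (hz : l.getLast? = some z) (hs : Fronts R l.reverse s) : s = z := by
  obtain ⟨l, rfl⟩ := List.getLast?_eq_some_iff.1 hz
  rw [List.reverse_append, List.reverse_singleton, List.singleton_append] at hs
  refine fronts_of_isChain hsymm ?_ hs
  rw [← List.singleton_append, ← List.reverse_singleton, ← List.reverse_append,
    List.isChain_reverse]
  exact hl.imp fun a b => hsymm a b

theorem exists_minimal_fronts_rel (hirr : ∀ a, ¬ R a a) (hsymm : ∀ a b, R a b → R b a)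
    (hR : ∀ s, ∃ t, R s t) (hcard : ∀ a b, ∃ c : B, c ≠ a ∧ c ≠ b)
    (hconn : ∀ a b, Relation.ReflTransGen R a b) (P : List B → Prop)
    (happ : ∀ l m, P l → P m → P (l ++ m)) (hconj : ∀ p l, P l → P (p :: (l ++ [p])))
    (hwalk : ∀ y z, R z y → ∃ l : List B, (y :: l).IsChain R ∧ (y :: l).getLast? = some z ∧
      (∀ b, b ∈ y :: l) ∧ P (y :: l)) (z : B) :
    ∃ v, Minimal R v ∧ P v ∧ (∀ b, b ∈ v) ∧ (∀ s, Fronts R v s → R z s) ∧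
      ∀ s, Fronts R v.reverse s → R z s := by
  have hblock {l : List B} (hl : ∀ b, b ∈ l) (s : B) : ¬ ∀ a ∈ l, ¬ R s a := by
    obtain ⟨t, ht⟩ := hR s
    exact fun h => h t (hl t) ht
  obtain ⟨t, hzt⟩ := hR z
  obtain ⟨l, hl, hlz, hlB, hlP⟩ := hwalk t z hzt
  have hfront {s : B} : Fronts R (t :: l) s → s = t := fronts_of_isChain hsymm hl
  have hback {s : B} : Fronts R (t :: l).reverse s → s = z := eq_of_fronts_reverse hsymm hl hlz
  by_cases hu : ∃ u, u ≠ z ∧ R t u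
  · obtain ⟨u, huz, htu⟩ := hu
    obtain ⟨m, hm, hmt, hmB, hmP⟩ := hwalk u t htu
    refine ⟨(t :: l) ++ (u :: m), minimal_append.2 ⟨minimal_of_isChain hirr hsymm hl,
      minimal_of_isChain hirr hsymm hm, fun s hs hs' => ?_⟩, happ _ _ hlP hmP,
      fun b => List.mem_append_left _ (hlB b), fun s hs => ?_, fun s hs => ?_⟩
    · exact huz ((fronts_of_isChain hsymm hm hs').symm.trans (hback hs))
    · rcases fronts_append.1 hs with hs | ⟨hs, -⟩
      · exact hfront hs ▸ hzt
      · exact (hblock hlB s hs).elim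
    · rw [List.reverse_append] at hs
      rcases fronts_append.1 hs with hs | ⟨hs, -⟩
      · exact eq_of_fronts_reverse hsymm hm hmt hs ▸ hzt
      · exact (hblock (fun b => List.mem_reverse.2 (hmB b)) s hs).elim
  · have hp : ∃ p, p ≠ t ∧ R z p := by
      by_contra! hp
      push Not at hu
      obtain ⟨c, hct, hcz⟩ := hcard t z
      have key (c : B) (h : Relation.ReflTransGen R z c) : c = t ∨ c = z := by
        induction h with
        | refl => exact Or.inr rfl
        | @tail b c _ hbc ih =>
          rcases ih with rfl | rfl
          · exact Or.inr (by_contra fun h => hu c h hbc)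
          · exact Or.inl (by_contra fun h => hp c h hbc)
      exact (key c (hconn z c)).elim hct hcz
    obtain ⟨p, hpt, hzp⟩ := hp
    have hpz : p ≠ z := fun h => hirr z (h ▸ hzp)
    refine ⟨p :: ((t :: l) ++ [p]), ⟨minimal_append.2 ⟨minimal_of_isChain hirr hsymm hl,
      ⟨trivial, id⟩, ?_⟩, fun hs => ?_⟩, hconj _ _ hlP,
      fun b => List.mem_cons_of_mem _ (List.mem_append_left _ (hlB b)),
      fun s hs => ?_, fun s hs => ?_⟩
    · rintro s hs (rfl | hs')
      · exact hpz (hback hs)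
      · exact hs'.2
    · rcases fronts_append.1 hs with hs | ⟨hs, -⟩
      · exact hpt (hfront hs)
      · exact hblock hlB p hs
    · rcases hs with rfl | ⟨-, hs⟩
      · exact hzp
      · rcases fronts_append.1 hs with hs | ⟨hs, -⟩
        · exact hfront hs ▸ hzt
        · exact (hblock hlB s hs).elim
    · rw [List.reverse_cons, List.reverse_append, List.reverse_singleton,
        List.singleton_append, List.cons_append] at hs
      rcases hs with rfl | ⟨hsp, hs⟩
      · exact hzp
      · rcases fronts_append.1 hs with hs | ⟨hs, -⟩
        · exact (hsp (hback hs ▸ hzp)).elim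
        · exact (hblock (fun b => List.mem_reverse.2 (hlB b)) s hs).elim

end BlockedWord

theorem isVirtuallyFreeAbelian_or_finite_of_two_generators {B W : Type*} [Group W]
    {M : CoxeterMatrix B} (cs : CoxeterSystem M W) {a b : B} (h : ∀ c, c = a ∨ c = b) :
    IsVirtuallyFreeAbelian W ∨ Finite W := by
  set ρ : W := cs.simple a * cs.simple b with hρ
  set H : Subgroup W := (zpowersHom W ρ).range with hH
  have hρH : ρ ∈ H := ⟨Multiplicative.ofAdd 1, by simp⟩
  have key (w : W) : w ∈ H ∨ cs.simple a * w ∈ H := by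
    induction w using cs.simple_induction_left with
    | one => exact Or.inl H.one_mem
    | mul_simple_left w c ih =>
      rcases h c with rfl | rfl
      · rw [cs.simple_mul_simple_cancel_left]
        exact ih.symm
      · rcases ih with ih | ih
        · right
          rw [← mul_assoc]
          exact H.mul_mem hρH ih
        · left
          have : cs.simple c * w = ρ⁻¹ * (cs.simple a * w) := by
            simp [hρ, mul_assoc]
          rw [this]
          exact H.mul_mem (H.inv_mem hρH) ih
  have hsurj : Function.Surjective fun x : Bool × H => cond x.1 (x.2 : W) (cs.simple a * x.2) := by
    intro w
    rcases key w with hw | hw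
    · exact ⟨(true, ⟨w, hw⟩), rfl⟩
    · exact ⟨(false, ⟨_, hw⟩), by simp⟩
  by_cases hfin : IsOfFinOrder ρ
  · right
    have : Finite H := by
      have : (H : Set W) = Subgroup.zpowers ρ := by
        ext x
        simp [hH, Subgroup.mem_zpowers_iff, Multiplicative.exists]
      exact (this ▸ hfin.finite_zpowers : (H : Set W).Finite)
    exact Finite.of_surjective _ hsurj
  · left
    refine ⟨H, ?_, Unit, ⟨?_⟩⟩
    · have : Finite (W ⧸ H) := by
        refine Finite.of_surjective
          (fun x : Bool => (QuotientGroup.mk (cond x 1 (cs.simple a)) : W ⧸ H)) fun q => ?_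
        induction q using QuotientGroup.induction_on with
        | H w =>
          rcases key w with hw | hw
          · exact ⟨true, QuotientGroup.eq.2 (by simpa using hw)⟩
          · exact ⟨false, QuotientGroup.eq.2 (by simpa using hw)⟩
      exact Subgroup.finiteIndex_of_finite_quotient
    · have hinj : Function.Injective (zpowersHom W ρ) := fun m n hmn =>
        injective_zpow_iff_not_isOfFinOrder.2 hfin hmn
      exact (MonoidHom.ofInjective hinj).symm.trans
        (AddEquiv.toMultiplicative (Finsupp.uniqueAddEquiv ()).symm)

namespace CoxeterSystem

open BlockedWord

variable {B W : Type*} [Group W] {M : CoxeterMatrix B} (cs : CoxeterSystem M W)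

theorem not_isBlocker_self (a : B) : ¬ cs.IsBlocker a a := fun h => h (Commute.refl _)

theorem IsBlocker.symm {cs : CoxeterSystem M W} {a b : B} (h : cs.IsBlocker a b) :
    cs.IsBlocker b a := fun h' => h (Commute.symm h')

theorem exists_isBlocker [Nontrivial B] (hirr : cs.IsIrreducible) (s : B) :
    ∃ t, cs.IsBlocker s t := by
  by_contra! h
  obtain ⟨t, ht⟩ := exists_ne s
  refine hirr ⟨{s}, Set.singleton_nonempty s, ⟨t, ht⟩, ?_⟩
  rintro _ rfl j -
  exact not_not.1 (h j)

theorem reflTransGen_isBlocker (hirr : cs.IsIrreducible) (a b : B) :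
    Relation.ReflTransGen cs.IsBlocker a b := by
  by_contra h
  refine hirr ⟨{c | Relation.ReflTransGen cs.IsBlocker a c}, ⟨a, .refl⟩, ⟨b, h⟩, ?_⟩
  intro i hi j hj
  by_contra hij
  exact hj (hi.tail hij)

theorem isLiftable_toggle (hra : M.IsRightAngled) (hR : ∀ s, ∃ t, cs.IsBlocker s t) :
    M.IsLiftable fun s => (toggle_involutive hR s).toPerm := by
  have hsq (s : B) : (toggle_involutive hR s).toPerm * (toggle_involutive hR s).toPerm = 1 :=
    Equiv.ext fun x => toggle_involutive hR s x
  intro i j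
  rcases eq_or_ne i j with rfl | hij
  · simp [hsq]
  · rcases hra i j hij with h | h
    · have hc : ¬ cs.IsBlocker i j := by
        refine not_not.2 ?_
        have := cs.simple_mul_simple_pow i j
        rw [h, sq, mul_eq_one_iff_eq_inv, mul_inv_rev, inv_simple, inv_simple] at this
        exact this
      have hcomm : Commute (toggle_involutive hR i).toPerm (toggle_involutive hR j).toPerm :=
        Equiv.ext fun x => toggle_comm (fun _ _ => IsBlocker.symm) hc x
      rw [h, hcomm.mul_pow, sq, sq, hsq, hsq, one_mul]
    · rw [h, pow_zero]

theorem fronts_iff_of_wordProd_eq (hra : M.IsRightAngled) (hR : ∀ s, ∃ t, cs.IsBlocker s t)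
    {l m : List B} (hl : Minimal cs.IsBlocker l) (hm : Minimal cs.IsBlocker m)
    (h : cs.wordProd l = cs.wordProd m) (s : B) :
    Fronts cs.IsBlocker l s ↔ Fronts cs.IsBlocker m s := by
  have hsymm (a b : B) : cs.IsBlocker a b → cs.IsBlocker b a := IsBlocker.symm
  have key (l : List B) (x) :
      cs.lift ⟨_, cs.isLiftable_toggle hra hR⟩ (cs.wordProd l) x =
        l.foldr (toggle cs.IsBlocker) x := by
    induction l with
    | nil => simp
    | cons a l ih =>
      rw [wordProd_cons, map_mul, Equiv.Perm.mul_apply, ih, lift_apply_simple]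
      rfl
  have hproj : proj cs.IsBlocker l = proj cs.IsBlocker m := by
    rw [← foldr_toggle hR hsymm hl, ← foldr_toggle hR hsymm hm, ← key, ← key, h]
  rw [fronts_iff_lead_pos hR hsymm, fronts_iff_lead_pos hR hsymm, hproj]

theorem exists_wordProd_of_fronts {l : List B} {s : B} (h : Fronts cs.IsBlocker l s) :
    ∃ m, cs.wordProd l = cs.simple s * cs.wordProd m ∧ l.length = m.length + 1 := by
  induction l with
  | nil => exact h.elim
  | cons a l ih =>
    rcases h with rfl | ⟨hsa, h⟩
    · exact ⟨l, cs.wordProd_cons _ _, rfl⟩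
    · obtain ⟨m, hm, hlen⟩ := ih h
      refine ⟨a :: m, ?_, by simp [hlen]⟩
      rw [wordProd_cons, wordProd_cons, hm, ← mul_assoc, ← mul_assoc, (not_not.1 hsa).eq]

theorem ReducedWord.minimal {cs : CoxeterSystem M W} {l : List B} (h : cs.ReducedWord l) :
    Minimal cs.IsBlocker l := by
  induction l with
  | nil => trivial
  | cons a l ih =>
    refine ⟨ih fun m hm => ?_, fun hf => ?_⟩
    · have := h (a :: m) (by rw [wordProd_cons, wordProd_cons, hm])
      simpa using this
    · obtain ⟨m, hm, hlen⟩ := cs.exists_wordProd_of_fronts hf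
      have := h m (by rw [wordProd_cons, hm, simple_mul_simple_cancel_left])
      simp only [List.length_cons] at this
      omega

theorem sMinimal_of_minimal {l : List B} (h : Minimal cs.IsBlocker l) (s : B) :
    cs.SMinimal l s := by
  rintro l₁ l₂ l₃ rfl -
  by_contra! hb
  rw [List.append_assoc, List.cons_append] at h
  exact (minimal_append.1 h).2.1.2 (fronts_append.2 (Or.inr ⟨hb, Or.inl rfl⟩))

theorem fronts_of_not_isBlocker {l₁ l₂ l₃ : List B} {s : B}
    (h : ∀ t ∈ l₃ ++ l₁, ¬ cs.IsBlocker s t) :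
    Fronts cs.IsBlocker (l₁ ++ s :: l₂ ++ s :: l₃) s ∧
      Fronts cs.IsBlocker (l₁ ++ s :: l₂ ++ s :: l₃).reverse s := by
  simp only [List.forall_mem_append] at h
  constructor
  · rw [List.append_assoc, List.cons_append]
    exact fronts_append.2 (Or.inr ⟨h.2, Or.inl rfl⟩)
  · rw [List.reverse_append, List.reverse_cons, List.append_assoc]
    exact fronts_append.2 (Or.inr ⟨by simpa using h.1, Or.inl rfl⟩)

theorem sGood_of_not_fronts {l : List B} (hl : Minimal cs.IsBlocker l) {s : B}
    (h : Fronts cs.IsBlocker l s → ¬ Fronts cs.IsBlocker l.reverse s) : cs.SGood l s := by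
  refine ⟨cs.sMinimal_of_minimal hl s, ?_⟩
  rintro l₁ l₂ l₃ rfl - -
  by_contra! hb
  have := cs.fronts_of_not_isBlocker (l₂ := l₂) hb
  exact h this.1 this.2

theorem fronts_of_mem_badSet {l : List B} (hl : Minimal cs.IsBlocker l) {s : B}
    (h : s ∈ cs.badSet l) :
    Fronts cs.IsBlocker l s ∧ Fronts cs.IsBlocker l.reverse s := by
  by_contra h'
  exact h (cs.sGood_of_not_fronts hl fun h₁ h₂ => h' ⟨h₁, h₂⟩)

theorem not_isBlocker_of_fronts {l₁ l₂ : List B} {s : B} (hs : s ∉ l₁)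
    (h : Fronts cs.IsBlocker (l₁ ++ s :: l₂) s) : ∀ t ∈ l₁, ¬ cs.IsBlocker s t :=
  (fronts_append.1 h).elim (fun h => (hs h.mem).elim) And.left

theorem mem_badSet_of_fronts {l : List B} (hR : ∀ s, ∃ t, cs.IsBlocker s t)
    (hB : ∀ b, b ∈ l) {s : B} (h : Fronts cs.IsBlocker l s)
    (h' : Fronts cs.IsBlocker l.reverse s) : s ∈ cs.badSet l := by
  intro hgood
  obtain ⟨l₁, m, rfl, hl₁⟩ := List.eq_append_cons_of_mem (hB s)
  have h₁ := cs.not_isBlocker_of_fronts hl₁ h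
  by_cases hm : s ∈ m
  · obtain ⟨l₃, l₂, hm', hl₃⟩ := List.eq_append_cons_of_mem (List.mem_reverse.2 hm)
    obtain rfl : m = l₂.reverse ++ s :: l₃.reverse := by
      rw [← m.reverse_reverse, hm']; simp
    have h₃ := cs.not_isBlocker_of_fronts (l₂ := l₂ ++ s :: l₁.reverse) hl₃ (by simpa using h')
    obtain ⟨t, ht, hst⟩ := hgood.2 l₁ l₂.reverse l₃.reverse (by simp) hl₁ (by simpa using hl₃)
    rcases List.mem_append.1 ht with ht | ht
    · exact h₃ t (List.mem_reverse.1 ht) hst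
    · exact h₁ t ht hst
  · have h₂ := cs.not_isBlocker_of_fronts (l₁ := m.reverse) (l₂ := l₁.reverse) (by simpa using hm)
      (by simpa using h')
    obtain ⟨t, ht⟩ := hR s
    rcases List.mem_append.1 (hB t) with hl | hl
    · exact h₁ t hl ht
    · rcases List.mem_cons.1 hl with rfl | hl
      · exact cs.not_isBlocker_self _ ht
      · exact h₂ t (List.mem_reverse.2 hl) ht

theorem exists_isChain_wordProd_mem [Finite B] (hirr : cs.IsIrreducible) (T : Subgroup W)
    [T.Normal] (hT : T.FiniteIndex) {y z : B} (hzy : cs.IsBlocker z y) :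
    ∃ l : List B, (y :: l).IsChain cs.IsBlocker ∧ (y :: l).getLast? = some z ∧
      (∀ b, b ∈ y :: l) ∧ cs.wordProd (y :: l) ∈ T := by
  have := Fintype.ofFinite B
  obtain ⟨l, hl, hz, hB⟩ :=
    exists_isChain_supset (cs.reflTransGen_isBlocker hirr) y z Finset.univ.toList
  obtain ⟨n, hn⟩ := Nat.exists_eq_succ_of_ne_zero hT.index_ne_zero
  obtain ⟨l', h, h₁, h₂⟩ := isChain_flatten_replicate hl hz hzy n
  refine ⟨l', h₁, h₂, fun b => ?_, ?_⟩
  · rw [← h, List.replicate_succ, List.flatten_cons]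
    exact List.mem_append_left _ (hB b (by simp))
  · have hpow (m : ℕ) : cs.wordProd (List.replicate m (y :: l)).flatten =
        cs.wordProd (y :: l) ^ m := by
      induction m with
      | zero => simp
      | succ m ih => rw [List.replicate_succ, List.flatten_cons, wordProd_append, ih, pow_succ']
    rw [← h, hpow, ← Nat.succ_eq_add_one, ← hn]
    exact T.pow_index_mem _

end CoxeterSystem

open BlockedWord CoxeterSystem in
/-- Existence of `B`-cancellators. Let `T ⊴ W` be a proper normal subgroup of finite
index of an infinite, irreducible, non-affine right-angled Coxeter group. For every
subset `Bs ⊆ S` there is a word `v` representing an element of `T` such that for every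
reduced word `w` representing an element of `T`, containing every generator and with
bad set `B(w) = Bs`, every reduced expression of `v w` is `s`-good for all `s ∈ S`. -/
theorem stmt_13 {B W : Type*} [Fintype B] [Group W] {M : CoxeterMatrix B}
    (cs : CoxeterSystem M W) (hra : M.IsRightAngled) [Infinite W]
    (hirr : cs.IsIrreducible) (hnaff : ¬ IsVirtuallyFreeAbelian W)
    (T : Subgroup W) [T.Normal] (hTproper : T ≠ ⊤) (hTindex : T.FiniteIndex)
    (Bs : Set B) :
    ∃ v : List B, cs.wordProd v ∈ T ∧
      ∀ w : List B, cs.ReducedWord w → cs.wordProd w ∈ T → (∀ b : B, b ∈ w) →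
        cs.badSet w = Bs →
          ∀ r : List B, cs.ReducedWord r → cs.wordProd r = cs.wordProd (v ++ w) →
            ∀ s : B, cs.SGood r s := by
  classical
  have hcard (a b : B) : ∃ c, c ≠ a ∧ c ≠ b := by
    by_contra! h
    rcases isVirtuallyFreeAbelian_or_finite_of_two_generators cs
      (fun c => or_iff_not_imp_left.2 (h c)) with h | h
    · exact hnaff h
    · exact not_finite W
  rcases isEmpty_or_nonempty B with hB | ⟨⟨b₀⟩⟩
  · exact ⟨[], T.one_mem, fun _ _ _ _ _ _ _ _ s => hB.elim s⟩
  have : Nontrivial B := ⟨⟨_, _, (hcard b₀ b₀).choose_spec.1⟩⟩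
  have hR := cs.exists_isBlocker hirr
  have hsymm (a b : B) : cs.IsBlocker a b → cs.IsBlocker b a := IsBlocker.symm
  have hfront {l m : List B} := @fronts_iff_of_wordProd_eq _ _ _ _ cs hra hR l m
  rcases Bs.eq_empty_or_nonempty with rfl | ⟨z, hz⟩
  · refine ⟨[], T.one_mem, fun w hw _ hwB hbad r hr hrw s => ?_⟩
    rw [List.nil_append] at hrw
    refine cs.sGood_of_not_fronts hr.minimal fun h h' => ?_
    have : s ∈ cs.badSet w := cs.mem_badSet_of_fronts hR hwB
      ((hfront hr.minimal hw.minimal hrw s).1 h)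
      ((hfront hr.minimal.reverse hw.minimal.reverse (by simp [hrw]) s).1 h')
    simp [hbad] at this
  · obtain ⟨v, hv, hvT, hvB, hvf, hvb⟩ := exists_minimal_fronts_rel cs.not_isBlocker_self hsymm hR
      hcard (cs.reflTransGen_isBlocker hirr) (fun l => cs.wordProd l ∈ T)
      (fun l m hl hm => by rw [cs.wordProd_append]; exact T.mul_mem hl hm)
      (fun p l hl => by
        have := ‹T.Normal›.conj_mem _ hl (cs.simple p)
        rwa [cs.inv_simple, mul_assoc, ← cs.wordProd_singleton, ← cs.wordProd_append,
          cs.wordProd_singleton, ← cs.wordProd_cons] at this)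
      (fun y z hzy => cs.exists_isChain_wordProd_mem hirr T hTindex hzy) z
    refine ⟨v, hvT, fun w hw _ hwB hbad r hr hrw s => ?_⟩
    obtain ⟨hzf, hzb⟩ := cs.fronts_of_mem_badSet hw.minimal (hbad ▸ hz : z ∈ cs.badSet w)
    have hvw : Minimal cs.IsBlocker (v ++ w) := minimal_append.2 ⟨hv, hw.minimal, fun s hs hs' =>
      not_rel_of_fronts cs.not_isBlocker_self hsymm hzf hs' (hvb s hs)⟩
    refine cs.sGood_of_not_fronts hr.minimal fun h h' => ?_
    rw [hfront hr.minimal hvw hrw] at h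
    rw [hfront hr.minimal.reverse hvw.reverse
      (by rw [cs.wordProd_reverse, cs.wordProd_reverse, hrw]), List.reverse_append] at h'
    obtain ⟨t, ht⟩ := hR s
    rcases fronts_append.1 h with h | ⟨h, -⟩
    · rcases fronts_append.1 h' with h' | ⟨h', -⟩
      · exact not_rel_of_fronts cs.not_isBlocker_self hsymm hzb h' (hvf s h)
      · exact h' t (List.mem_reverse.2 (hwB t)) ht
    · exact h t (hvB t) ht
end
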